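/- In the game of tic-tac-toe on the explicit affine plane π₄ (players alternately claim unclaimed points; a player wins upon owning all 4 points of some line; the first player is Xeno), Xeno has a winning strategy. -/

import Mathlib

/-- Points of the explicit affine plane π₄: `(g, i)` where `g = 0,1,2,3`
indicates the group (rows rᵢ, columns cᵢ, symbols αᵢ, symbols βᵢ) and `i`
the (0-based) index; e.g. r₁ = (0,0), c₃ = (1,2), α₂ = (2,1), β₄ = (3,3). -/
abbrev Pt := Fin 4 × Fin 4

/-- First latin square of Figure 1 (0-indexed). -/
def L1 : Fin 4 → Fin 4 → Fin 4 :=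
  ![![0, 1, 2, 3], ![1, 0, 3, 2], ![2, 3, 0, 1], ![3, 2, 1, 0]]

/-- Second latin square of Figure 1 (0-indexed). -/
def L2 : Fin 4 → Fin 4 → Fin 4 :=
  ![![0, 1, 2, 3], ![3, 2, 1, 0], ![1, 0, 3, 2], ![2, 3, 0, 1]]

/-- Third latin square of Figure 1 (0-indexed), used to index parallel classes. -/
def L3 : Fin 4 → Fin 4 → Fin 4 :=
  ![![0, 1, 2, 3], ![2, 3, 0, 1], ![3, 2, 1, 0], ![1, 0, 3, 2]]

/-- The block {r_i, c_j, α_{L1 i j}, β_{L2 i j}} of the RTD(4,4) (Figure 2). -/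
def blk (i j : Fin 4) : Finset Pt :=
  {(0, i), (1, j), (2, L1 i j), (3, L2 i j)}

/-- The group {rᵢ}, {cᵢ}, {αᵢ} or {βᵢ} (the index parallel class, Figure 3). -/
def grp (g : Fin 4) : Finset Pt := {(g, 0), (g, 1), (g, 2), (g, 3)}

/-- The 20 lines of the explicit affine plane π₄: the 16 blocks plus the 4 groups. -/
def pi4Lines : Finset (Finset Pt) :=
  (Finset.univ.image fun p : Fin 4 × Fin 4 => blk p.1 p.2) ∪
    Finset.univ.image grp

/-- A point set contains a full line of π₄. -/
def HasLine (S : Finset Pt) : Prop := ∃ l ∈ pi4Lines, l ⊆ S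

/-- `XenoWinsIn k Xs Os`: with Xeno (the first player) to move, Xeno holding
`Xs` and Ophelia holding `Os`, Xeno can force a win within his next `k` moves:
he has a move, either completing a line immediately, or such that the game is
not over and against every Ophelia reply (which must not complete a line for
her) he can force a win within `k − 1` further moves. -/
def XenoWinsIn : ℕ → Finset Pt → Finset Pt → Prop
  | 0, _, _ => False
  | k + 1, Xs, Os =>
    ∃ x, x ∉ Xs ∪ Os ∧
      (HasLine (insert x Xs) ∨
        (insert x Xs ∪ Os ≠ Finset.univ ∧
          ∀ o, o ∉ insert x Xs ∪ Os →
            ¬HasLine (insert o Os) ∧ XenoWinsIn k (insert x Xs) (insert o Os)))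

/-! Xeno opens at `(0, 0)`. A collineation of order 15 fixing `(0, 0)` permutes the other points
cyclically, so only the reply `(1, 0)` has to be analysed; there a precomputed strategy is checked
by evaluation, on positions encoded as bitmasks. -/

/-- The position of a point in a bitmask. -/
def code (p : Pt) : ℕ := 4 * p.1 + p.2

/-- The set of points encoded by a bitmask. -/
def decode (m : ℕ) : Finset Pt := Finset.univ.filter fun p => m.testBit (code p)

/-- The lines of π₄ as bitmasks. -/
def lineMasks : List ℕ :=
  [4369, 8737, 17473, 34945, 33298, 16674, 10306, 5250, 9236, 6180, 33092, 17028, 18456, 33832,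
   4680, 8584, 15, 240, 3840, 61440]

/-- The bitmask `m` contains a full line. -/
def hasLineMask (m : ℕ) : Bool := lineMasks.any fun l => Nat.beq (Nat.land l m) l

/-- The point with code `i` exists and is unoccupied in `m`. -/
def isFree (m i : ℕ) : Bool :=
  Nat.blt i 16 && Nat.beq (Nat.land m (2 ^ i)) 0

/-- The player holding `x` can complete a line on a point that is free in `x` and `o`. -/
def canComplete (x o : ℕ) : Bool :=
  lineMasks.any fun l =>
    let i := Nat.log2 (Nat.xor l (Nat.land l x))
    Nat.beq (Nat.land l (Nat.lor x (2 ^ i))) l && isFree (Nat.lor x o) i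

/-- Run `f` on the given replies one after the other, threading the list of moves not yet used. -/
def runReplies (f : ℕ → List ℕ → Option (List ℕ)) : List ℕ → List ℕ → Option (List ℕ)
  | [], ms => some ms
  | i :: is, ms =>
    match f i ms with
    | some ms' => runReplies f is ms'
    | none => none

/-- Check that Xeno wins in `k` moves by completing a line whenever he can and otherwise playing
the moves `ms`, listed in depth-first order of the game tree. Returns the moves not used. -/
def runStrategy : ℕ → ℕ → ℕ → List ℕ → Option (List ℕ)
  | 0, _, _, _ => none
  | k + 1, x, o, ms =>
    bif canComplete x o then some ms else
      match ms with
      | [] => none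
      | i :: ms =>
        bif isFree (Nat.lor x o) i && !Nat.beq (Nat.lor (Nat.lor x (2 ^ i)) o) 65535 then
          runReplies (fun j ms =>
            bif isFree (Nat.lor (Nat.lor x (2 ^ i)) o) j then
              bif hasLineMask (Nat.lor o (2 ^ j)) then none
              else runStrategy k (Nat.lor x (2 ^ i)) (Nat.lor o (2 ^ j)) ms
            else some ms) (List.range 16) ms
        else none

/-- Xeno's moves after `(0, 0)` is answered by `(1, 0)`, in the format of `runStrategy`. -/
def responses : List ℕ :=
  [1, 10, 6, 11, 7, 6, 7, 11, 7, 5, 9, 8, 15, 3, 8, 3, 8, 15, 15, 8, 13, 14, 5, 15, 13, 6, 7,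
   11, 6, 7, 11, 12, 14, 5, 15, 5, 14, 8, 9, 14, 6, 13, 14, 14, 14, 9, 15, 11, 14, 7, 11, 14,
   8, 7, 11, 13, 8, 6, 11, 12, 9, 11, 6, 10, 7, 6, 7, 10, 7, 5, 8, 9, 2, 9, 12, 2, 9, 9, 14,
   12, 12, 13, 5, 12, 14, 6, 7, 10, 6, 7, 10, 13, 5, 12, 14, 6, 10, 15, 8, 7, 10, 14, 9, 7, 10,
   13, 9, 5, 13, 8, 9, 13, 13, 6, 14, 13, 13, 8, 12, 10, 13, 6, 10, 7, 11, 10, 11, 7, 2, 8, 10,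
   11, 3, 10, 12, 2, 11, 15, 2, 15, 11, 3, 12, 10, 2, 11, 15, 3, 10, 12, 2, 11, 15, 3, 10, 12,
   5, 8, 7, 11, 9, 3, 10, 13, 3, 10, 13, 10, 15, 13, 9, 7, 10, 8, 2, 11, 2, 11, 14, 14, 11, 12,
   14, 2, 8, 11, 9, 2, 9, 7, 11, 3, 8, 7, 10, 2, 9, 14, 2, 14, 9, 2, 9, 14, 2, 12, 14, 7, 3,
   13, 7, 15, 2, 9, 14, 5, 13, 14, 6, 13, 6, 14, 2, 8, 11, 9, 2, 13, 11, 3, 14, 10, 2, 11, 13,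
   3, 10, 14, 3, 10, 14, 3, 10, 14, 2, 11, 13, 2, 11, 13, 2, 7, 10, 14, 11, 12, 11, 12, 9, 11,
   5, 14, 10, 9, 11, 13, 10, 14, 11, 12, 10, 14, 2, 6, 11, 15, 8, 14, 10, 11, 7, 11, 15, 14, 8,
   8, 14, 8, 14, 11, 15, 10, 11, 12, 3, 13, 7, 11, 5, 8, 6, 9, 6, 9, 7, 11, 5, 8, 5, 8, 6, 9,
   5, 8, 2, 14, 7, 10, 5, 9, 6, 8, 7, 10, 6, 8, 5, 9, 5, 9, 6, 8, 5, 9, 2, 6, 11, 15, 8, 14,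
   11, 7, 14, 8, 14, 11, 15, 14, 8, 8, 14, 11, 15, 13, 14, 5, 3, 10, 6, 12, 7, 15, 5, 14, 6,
   12, 5, 14, 5, 14, 5, 14, 7, 15, 6, 12, 2, 11, 6, 15, 7, 12, 5, 13, 5, 13, 6, 15, 5, 13, 6,
   15, 7, 12, 5, 13, 2, 5, 9, 14, 11, 13, 11, 13, 11, 6, 14, 9, 14, 14, 9, 9, 14, 12, 14, 7,
   11, 13]

/-- A collineation of order 15 fixing `(0, 0)`. -/
def turn (p : Pt) : Pt :=
  ![![(0, 0), (1, 0), (3, 0), (2, 0)],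
    ![(1, 1), (3, 3), (0, 3), (2, 2)],
    ![(2, 1), (1, 3), (0, 2), (3, 2)],
    ![(3, 1), (2, 3), (0, 1), (1, 2)]] p.1 p.2

theorem code_lt (p : Pt) : code p < 16 := by
  have h1 := p.1.isLt
  have h2 := p.2.isLt
  unfold code
  omega

theorem code_injective : Function.Injective code := by
  decide

theorem exists_code_eq {i : ℕ} (hi : i < 16) : ∃ p, code p = i :=
  ⟨(⟨i / 4, by omega⟩, ⟨i % 4, by omega⟩), by simp only [code]; omega⟩

theorem mem_decode {m : ℕ} {p : Pt} : p ∈ decode m ↔ m.testBit (code p) = true := by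
  simp [decode]

theorem decode_lor (a b : ℕ) : decode (Nat.lor a b) = decode a ∪ decode b := by
  ext p
  simp [mem_decode]

theorem decode_two_pow (p : Pt) : decode (2 ^ code p) = {p} := by
  ext q
  simp [mem_decode, Nat.testBit_two_pow, code_injective.eq_iff, eq_comm]

theorem decode_lor_two_pow (m : ℕ) (p : Pt) :
    decode (Nat.lor m (2 ^ code p)) = insert p (decode m) := by
  rw [decode_lor, decode_two_pow, Finset.union_comm]
  rfl

theorem isFree_code {m : ℕ} {p : Pt} : isFree m (code p) = true ↔ p ∉ decode m := by
  simp [isFree, Nat.blt_eq, code_lt, mem_decode, Nat.and_two_pow]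

theorem exists_of_isFree {m i : ℕ} (h : isFree m i = true) : ∃ p, code p = i ∧ p ∉ decode m := by
  have hi : i < 16 := by
    simp only [isFree, Bool.and_eq_true, Nat.blt_eq] at h
    exact h.1
  obtain ⟨p, rfl⟩ := exists_code_eq hi
  exact ⟨p, rfl, isFree_code.1 h⟩

theorem pi4Lines_eq : pi4Lines = lineMasks.toFinset.image decode := by
  decide

theorem lineMasks_lt : ∀ l ∈ lineMasks, l < 2 ^ 16 := by
  decide

theorem decode_subset_decode {l m : ℕ} (hl : l < 2 ^ 16) :
    decode l ⊆ decode m ↔ Nat.land l m = l := by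
  have h : Nat.land l m = l &&& m := rfl
  rw [h]
  constructor
  · intro hs
    refine Nat.eq_of_testBit_eq fun i => ?_
    rw [Nat.testBit_and]
    by_cases hi : i < 16
    · obtain ⟨p, rfl⟩ := exists_code_eq hi
      have := @hs p
      simp only [mem_decode] at this
      cases hb : l.testBit (code p) <;> simp_all
    · have : l.testBit i = false :=
        Nat.testBit_lt_two_pow (hl.trans_le (Nat.pow_le_pow_right (by norm_num) (by omega)))
      simp [this]
  · intro he p hp
    rw [mem_decode] at hp ⊢
    rw [← he, Nat.testBit_and, Bool.and_eq_true] at hp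
    exact hp.2

theorem hasLine_decode {m : ℕ} : HasLine (decode m) ↔ hasLineMask m = true := by
  simp only [HasLine, pi4Lines_eq, hasLineMask, List.any_eq_true, Finset.mem_image,
    List.mem_toFinset, Nat.beq_eq]
  constructor
  · rintro ⟨_, ⟨l, hl, rfl⟩, hs⟩
    exact ⟨l, hl, (decode_subset_decode (lineMasks_lt l hl)).1 hs⟩
  · rintro ⟨l, hl, he⟩
    exact ⟨_, ⟨l, hl, rfl⟩, (decode_subset_decode (lineMasks_lt l hl)).2 he⟩

theorem exists_hasLine_of_canComplete {x o : ℕ} (h : canComplete x o = true) :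
    ∃ p, p ∉ decode x ∪ decode o ∧ HasLine (insert p (decode x)) := by
  obtain ⟨l, hl, h⟩ := List.any_eq_true.1 h
  obtain ⟨hline, hfree⟩ := Bool.and_eq_true_iff.1 h
  obtain ⟨p, hp, hmem⟩ := exists_of_isFree hfree
  rw [← hp] at hline
  refine ⟨p, decode_lor x o ▸ hmem, ?_⟩
  rw [← decode_lor_two_pow, hasLine_decode]
  exact List.any_eq_true.2 ⟨l, hl, hline⟩

theorem exists_run_of_runReplies {f : ℕ → List ℕ → Option (List ℕ)} {is ms ms' : List ℕ}
    (h : runReplies f is ms = some ms') {i : ℕ} (hi : i ∈ is) : ∃ a b, f i a = some b := by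
  induction is generalizing ms with
  | nil => simp at hi
  | cons j is ih =>
    rw [runReplies] at h
    split at h
    · rename_i b hb
      rcases List.mem_cons.1 hi with rfl | hi
      · exact ⟨ms, b, hb⟩
      · exact ih h hi
    · simp at h

theorem decode_ne_univ {m : ℕ} (hm : m < 2 ^ 16) (h : m ≠ 65535) : decode m ≠ Finset.univ := by
  intro he
  have hs : decode 65535 ⊆ decode m := he ▸ Finset.subset_univ _
  rw [decode_subset_decode (by norm_num)] at hs
  have : Nat.land 65535 m ≤ m := Nat.and_le_right
  omega

/-- Bitmasks of positions stay below `2 ^ 16` when a point is added. -/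
theorem lor_two_pow_lt {m : ℕ} (hm : m < 2 ^ 16) (p : Pt) : Nat.lor m (2 ^ code p) < 2 ^ 16 :=
  Nat.or_lt_two_pow hm (Nat.pow_lt_pow_right (by norm_num) (code_lt p))

theorem xenoWinsIn_of_runStrategy {k x o : ℕ} {ms ms' : List ℕ} (hx : x < 2 ^ 16)
    (ho : o < 2 ^ 16) (h : runStrategy k x o ms = some ms') :
    XenoWinsIn k (decode x) (decode o) := by
  induction k generalizing x o ms ms' with
  | zero => simp [runStrategy] at h
  | succ k ih =>
    unfold runStrategy at h
    rw [XenoWinsIn]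
    cases hc : canComplete x o with
    | true =>
      obtain ⟨p, hp, hl⟩ := exists_hasLine_of_canComplete hc
      exact ⟨p, hp, Or.inl hl⟩
    | false =>
      rw [hc, cond_false] at h
      cases ms with
      | nil => simp at h
      | cons i ms =>
        simp only [Bool.cond_eq_ite, Bool.and_eq_true, Bool.not_eq_true'] at h
        split_ifs at h with hi
        obtain ⟨hfree, hfull⟩ := hi
        obtain ⟨p, rfl, hp⟩ := exists_of_isFree hfree
        have hx' := lor_two_pow_lt hx p
        refine ⟨p, decode_lor x o ▸ hp, Or.inr ?_⟩
        rw [← decode_lor_two_pow, ← decode_lor]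
        refine ⟨decode_ne_univ (Nat.or_lt_two_pow hx' ho) (Nat.ne_of_beq_eq_false hfull),
          fun q hq => ?_⟩
        obtain ⟨a, b, hab⟩ := exists_run_of_runReplies h (List.mem_range.2 (code_lt q))
        rw [if_pos (isFree_code.2 hq)] at hab
        split_ifs at hab with hl
        rw [← decode_lor_two_pow, hasLine_decode]
        exact ⟨hl, ih hx' (lor_two_pow_lt ho q) hab⟩

theorem hasLine_image {f : Pt → Pt} (hf : ∀ l ∈ pi4Lines, l.image f ∈ pi4Lines) {S : Finset Pt}
    (h : HasLine S) : HasLine (S.image f) := by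
  obtain ⟨l, hl, hs⟩ := h
  exact ⟨l.image f, hf l hl, Finset.image_subset_image hs⟩

/-- An injective map of a finite plane taking lines to lines takes only lines to lines. -/
theorem hasLine_of_hasLine_image {f : Pt → Pt} (hinj : Function.Injective f)
    (hf : ∀ l ∈ pi4Lines, l.image f ∈ pi4Lines) {S : Finset Pt} (h : HasLine (S.image f)) :
    HasLine S := by
  obtain ⟨l, hl, hs⟩ := h
  obtain ⟨l', hl', rfl⟩ := Finset.surj_on_of_inj_on_of_card_le (fun l _ => l.image f) hf
    (fun _ _ _ _ h => Finset.image_injective hinj h) le_rfl l hl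
  exact ⟨l', hl', (Finset.image_subset_image_iff hinj).1 hs⟩

theorem XenoWinsIn.image {f : Pt → Pt} (hinj : Function.Injective f)
    (hf : ∀ l ∈ pi4Lines, l.image f ∈ pi4Lines) {k : ℕ} {Xs Os : Finset Pt}
    (h : XenoWinsIn k Xs Os) : XenoWinsIn k (Xs.image f) (Os.image f) := by
  induction k generalizing Xs Os with
  | zero => exact h
  | succ k ih =>
    obtain ⟨x, hx, h⟩ := h
    refine ⟨f x, ?_, ?_⟩
    · rwa [← Finset.image_union, hinj.mem_finset_image]
    rw [← Finset.image_insert, ← Finset.image_union]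
    refine h.imp (hasLine_image hf) fun ⟨hne, h⟩ => ⟨fun he => hne ?_, fun o ho => ?_⟩
    · refine Finset.eq_univ_of_forall fun p => ?_
      rw [← hinj.mem_finset_image, he]
      exact Finset.mem_univ _
    · obtain ⟨o, rfl⟩ := Finite.surjective_of_injective hinj o
      rw [hinj.mem_finset_image] at ho
      rw [← Finset.image_insert]
      exact ⟨fun hl => (h o ho).1 (hasLine_of_hasLine_image hinj hf hl), ih (h o ho).2⟩

theorem turn_injective : Function.Injective turn := by
  decide

theorem mem_pi4Lines {l : Finset Pt} :
    l ∈ pi4Lines ↔ (∃ i j, blk i j = l) ∨ ∃ g, grp g = l := by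
  simp [pi4Lines]

theorem image_turn_mem_pi4Lines : ∀ l ∈ pi4Lines, l.image turn ∈ pi4Lines := by
  have hblk : ∀ i j, (∃ i' j', blk i' j' = (blk i j).image turn) ∨
      ∃ g, grp g = (blk i j).image turn := by
    simp only [blk, Finset.image_insert, Finset.image_singleton]
    decide
  have hgrp : ∀ g, (∃ i' j', blk i' j' = (grp g).image turn) ∨
      ∃ g', grp g' = (grp g).image turn := by
    simp only [grp, Finset.image_insert, Finset.image_singleton]
    decide
  intro l hl
  rcases mem_pi4Lines.1 hl with ⟨i, j, rfl⟩ | ⟨g, rfl⟩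
  · exact mem_pi4Lines.2 (hblk i j)
  · exact mem_pi4Lines.2 (hgrp g)

theorem exists_iterate_turn_eq :
    ∀ o : Pt, o ≠ (0, 0) → ∃ n < 15, turn^[n] (1, 0) = o := by
  decide

theorem runStrategy_responses : runStrategy 7 1 16 responses = some [] := by
  decide +kernel

theorem xenoWinsIn_iterate_turn (n : ℕ) :
    XenoWinsIn 7 {(0, 0)} {turn^[n] (1, 0)} := by
  induction n with
  | zero =>
    have h := xenoWinsIn_of_runStrategy (by norm_num) (by norm_num) runStrategy_responses
    rwa [show decode 1 = {(0, 0)} from decode_two_pow (0, 0),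
      show decode 16 = {(1, 0)} from decode_two_pow (1, 0)] at h
  | succ n ih =>
    have h := ih.image turn_injective image_turn_mem_pi4Lines
    rwa [Finset.image_singleton, Finset.image_singleton, ← Function.iterate_succ_apply' turn,
      show turn (0, 0) = (0, 0) from rfl] at h

theorem not_hasLine_singleton : ∀ o : Pt, ¬HasLine {o} := by
  unfold HasLine
  decide

/-- Tic-tac-toe on the explicit affine plane π₄ is a first player (Xeno) win:
from the empty position Xeno has a winning strategy (the game lasts at most 8
rounds, so winning within 8 of his moves is winning the game). -/
theorem stmt13 : XenoWinsIn 8 ∅ ∅ := by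
  refine ⟨(0, 0), by simp, Or.inr ⟨by decide, fun o ho => ⟨not_hasLine_singleton o, ?_⟩⟩⟩
  obtain ⟨n, -, rfl⟩ := exists_iterate_turn_eq o (by simpa using ho)
  exact xenoWinsIn_iterate_turn n
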